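/- arXiv:1105.2476 — 2 statements merged into one kernel-verified Lean document; each statement's English description precedes it below -/
import Mathlib

section
/- Let (H_n)_{n∈ℕ} be a family of complex Hilbert spaces. For each n let T_n be a (possibly unbounded) linear operator in H_n defined on a subspace dom(T_n), let λ ∈ ℂ, and let R_n be a compact bounded linear operator on H_n such that: (i) for every x ∈ H_n, R_n x ∈ dom(T_n) and T_n(R_n x) − λ·(R_n x) = x, and (ii) for every y ∈ dom(T_n), R_n(T_n y − λ y) = y. Assume ‖R_n‖ → 0 as n → ∞, and let R be a bounded linear operator on the Hilbert space direct sum ⊕₂H_n with (R u)_n = R_n(u_n) for every u and n. Then R is a compact operator on ⊕₂H_n, R is injective, and for every v ∈ ⊕₂H_n such that v_n ∈ dom(T_n) for all n and such that the sequence w defined by w_n = T_n(v_n) − λ v_n belongs to ⊕₂H_n, one has R w = v. -/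
/-- A pointwise bound `‖f i‖ ≤ C * ‖g i‖` gives the same bound on `ℓᵖ` norms. -/
theorem lp_norm_le_mul_of_forall_norm_le {ι : Type*} {E : ι → Type*}
    [∀ i, NormedAddCommGroup (E i)] {p : ENNReal} (hp : 0 < p.toReal) {C : ℝ} (hC : 0 ≤ C)
    {f g : lp E p} (h : ∀ i, ‖f i‖ ≤ C * ‖g i‖) : ‖f‖ ≤ C * ‖g‖ := by
  refine lp.norm_le_of_forall_sum_le hp (mul_nonneg hC (lp.norm_nonneg' g)) fun s => ?_
  calc ∑ i ∈ s, ‖f i‖ ^ p.toReal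
      ≤ ∑ i ∈ s, C ^ p.toReal * ‖g i‖ ^ p.toReal := by
        refine Finset.sum_le_sum fun i _ => ?_
        rw [← Real.mul_rpow hC (norm_nonneg _)]
        exact Real.rpow_le_rpow (norm_nonneg _) (h i) hp.le
    _ = C ^ p.toReal * ∑ i ∈ s, ‖g i‖ ^ p.toReal := (Finset.mul_sum _ _ _).symm
    _ ≤ C ^ p.toReal * ‖g‖ ^ p.toReal := by
        gcongr
        exact lp.sum_rpow_le_norm_rpow hp g s
    _ = (C * ‖g‖) ^ p.toReal := (Real.mul_rpow hC (lp.norm_nonneg' g)).symm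

/-- A diagonal operator on an `ℓᵖ` direct sum, `1 ≤ p < ∞`, whose blocks are compact with norms
tending to zero is compact. -/
theorem isCompactOperator_lp_of_tendsto_norm_zero {𝕜 : Type*} [NontriviallyNormedField 𝕜]
    {E : ℕ → Type*} [∀ n, NormedAddCommGroup (E n)] [∀ n, NormedSpace 𝕜 (E n)]
    [∀ n, CompleteSpace (E n)] {p : ENNReal} [Fact (1 ≤ p)] (hp : p ≠ ⊤)
    {R : ∀ n, E n →L[𝕜] E n} (hR : ∀ n, IsCompactOperator (R n))
    (hnorm : Filter.Tendsto (fun n => ‖R n‖) Filter.atTop (nhds 0))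
    {A : lp E p →L[𝕜] lp E p} (hA : ∀ u n, A u n = R n (u n)) : IsCompactOperator A := by
  have hp0 : 0 < p.toReal := ENNReal.toReal_pos (zero_lt_one.trans_le Fact.out).ne' hp
  let block (n : ℕ) : lp E p →L[𝕜] lp E p :=
    lp.singleContinuousLinearMap 𝕜 E p n ∘L R n ∘L lp.evalCLM 𝕜 E p n
  have hblock (n : ℕ) : block n ∈ compactOperator (RingHom.id 𝕜) (lp E p) (lp E p) :=
    ((hR n).comp_clm (lp.evalCLM 𝕜 E p n)).clm_comp (lp.singleContinuousLinearMap 𝕜 E p n)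
  refine isCompactOperator_of_tendsto (l := Filter.atTop)
    (F := fun N => ∑ n ∈ Finset.range N, block n) ?_
    (Filter.Eventually.of_forall fun N => Submodule.sum_mem _ fun n _ => hblock n)
  refine Metric.tendsto_atTop.2 fun ε hε => ?_
  obtain ⟨N, hN⟩ := Filter.eventually_atTop.1 (hnorm.eventually_lt_const (half_pos hε))
  refine ⟨N, fun M hM => ?_⟩
  rw [dist_comm, dist_eq_norm]
  refine (ContinuousLinearMap.opNorm_le_bound _ (half_pos hε).le fun u => ?_).trans_lt
    (half_lt_self hε)
  refine lp_norm_le_mul_of_forall_norm_le hp0 (half_pos hε).le fun k => ?_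
  have hsum : ((∑ n ∈ Finset.range M, block n) u) k = if k < M then R k (u k) else 0 := by
    have hcoord (n : ℕ) : block n u k = if k = n then R k (u k) else 0 := by
      change lp.single p n (R n (u n)) k = _
      split_ifs with h
      · subst h
        exact lp.single_apply_self p k _
      · exact lp.single_apply_ne p n _ h
    rw [sum_apply, lp.coeFn_sum, Finset.sum_apply]
    simp [hcoord]
  rw [sub_apply, lp.coeFn_sub, Pi.sub_apply, hA, hsum]
  split_ifs with hk
  · rw [sub_self, norm_zero]
    positivity
  · rw [sub_zero]
    exact (R k).le_of_opNorm_le (hN k (hM.trans (not_lt.1 hk))).le _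

/-- Theorem 4.6: suppose that for each `n` the (possibly unbounded) operator `Tₙ`, defined
on a subspace `dom Tₙ ⊆ Hₙ`, has a compact resolvent `Rₙ = (Tₙ − λ)⁻¹` at a common point
`λ`, and that `‖Rₙ‖ → 0`. Then the direct-sum operator `R = ⊕ Rₙ` on `⊕₂ Hₙ` is compact,
injective, and inverts `⊕ Tₙ − λ` on its natural domain; i.e. the direct sum `⊕ Tₙ` is an
operator with discrete spectrum. -/
theorem directSum_resolvent_compact
    (H : ℕ → Type*) [∀ n, NormedAddCommGroup (H n)]
    [∀ n, InnerProductSpace ℂ (H n)] [∀ n, CompleteSpace (H n)]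
    (dom : ∀ n, Submodule ℂ (H n))
    (T : ∀ n, dom n →ₗ[ℂ] H n)
    (lam : ℂ)
    (R : ∀ n, H n →L[ℂ] H n)
    (hRcpt : ∀ n, IsCompactOperator (R n))
    (hmem : ∀ (n : ℕ) (x : H n), R n x ∈ dom n)
    (hright : ∀ (n : ℕ) (x : H n), T n ⟨R n x, hmem n x⟩ - lam • R n x = x)
    (hleft : ∀ (n : ℕ) (y : dom n), R n (T n y - lam • (y : H n)) = (y : H n))
    (hnorm : Filter.Tendsto (fun n => ‖R n‖) Filter.atTop (nhds 0))
    (Rop : lp H 2 →L[ℂ] lp H 2)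
    (hRop : ∀ (u : lp H 2) (n : ℕ), (Rop u : ∀ n, H n) n = R n ((u : ∀ n, H n) n)) :
    IsCompactOperator Rop ∧ Function.Injective Rop ∧
      ∀ (v : lp H 2) (hv : ∀ n, (v : ∀ n, H n) n ∈ dom n)
        (hw : Memℓp (fun n => T n ⟨(v : ∀ n, H n) n, hv n⟩ - lam • (v : ∀ n, H n) n) 2),
        Rop ⟨_, hw⟩ = v := by
  refine ⟨isCompactOperator_lp_of_tendsto_norm_zero ENNReal.ofNat_ne_top hRcpt hnorm hRop,
    fun u v huv => ?_, fun v hv hw => ?_⟩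
  · have hR (n : ℕ) : Function.Injective (R n) := fun x y hxy => by
      rw [← hright n x, ← hright n y]
      simp only [hxy]
    ext n
    apply hR n
    rw [← hRop, ← hRop, huv]
  · ext n
    rw [hRop]
    exact hleft n ⟨_, hv n⟩
end

section
/- Let p be a real number with p > 2, let h > 0, let d : ℕ → ℝ satisfy 0 < d(n) ≤ h for all n, let λ : ℕ → ℕ → ℝ satisfy λ(n,m) ≥ 1 for all n, m, and let δ : ℕ → ℕ → ℝ satisfy 0 ≤ δ(n,m) < 2π for all n, m. Suppose the family (n,m) ↦ λ(n,m)^{−p/2} is summable over ℕ × ℕ. Then the family (n,k,m) ↦ (λ(n,m)² + (δ(n,m) + 2kπ)²/d(n)²)^{−p/2}, indexed over (n,k,m) ∈ ℕ × ℤ × ℕ, is summable. -/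
/-- For `b > 1` the family `(1 + |k|)^{-b}` is summable over the integers. -/
theorem summable_one_add_abs_int_rpow {b : ℝ} (hb : 1 < b) :
    Summable fun k : ℤ => (1 + |(k : ℝ)|) ^ (-b) := by
  refine Summable.of_nonneg_of_le (fun k => by positivity) (fun k => ?_)
    ((Real.summable_abs_int_rpow hb).add (hasSum_ite_eq (0 : ℤ) (1 : ℝ)).summable)
  by_cases hk : k = 0
  · subst hk
    simp only [Int.cast_zero, abs_zero, add_zero, Real.one_rpow, if_true]
    linarith [Real.rpow_nonneg (le_refl (0 : ℝ)) (-b)]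
  · have hk' : 0 < |(k : ℝ)| := abs_pos.mpr (Int.cast_ne_zero.mpr hk)
    rw [if_neg hk, add_zero]
    exact Real.rpow_le_rpow_of_nonpos hk' (by linarith) (by linarith)

/-- An angle in `[0, 2π)` shifted by `2kπ` and rescaled by a length at most `h` grows linearly
in `|k|`. -/
theorem abs_int_le_one_add_mul_abs_div {h d δ : ℝ} (hd : 0 < d) (hdh : d ≤ h) (hδ : 0 ≤ δ)
    (hδ' : δ < 2 * Real.pi) (k : ℤ) :
    |(k : ℝ)| ≤ 1 + h * |(δ + 2 * (k : ℝ) * Real.pi) / d| := by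
  have hpi : 3 < Real.pi := Real.pi_gt_three
  have hs : |δ + 2 * (k : ℝ) * Real.pi| ≤ h * |(δ + 2 * (k : ℝ) * Real.pi) / d| := by
    rw [abs_div, abs_of_pos hd, ← mul_div_assoc, le_div_iff₀ hd, mul_comm]
    exact mul_le_mul_of_nonneg_right hdh (abs_nonneg _)
  have htri : 2 * Real.pi * |(k : ℝ)| ≤ |δ + 2 * (k : ℝ) * Real.pi| + δ := by
    have h1 := abs_sub (δ + 2 * (k : ℝ) * Real.pi) δ
    rwa [add_sub_cancel_left, abs_mul, abs_mul, abs_of_pos Real.pi_pos, abs_of_nonneg hδ,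
      abs_two, mul_right_comm] at h1
  have hk : 2 * Real.pi * |(k : ℝ)| ≤ 2 * Real.pi * (1 + |δ + 2 * (k : ℝ) * Real.pi|) := by
    nlinarith [abs_nonneg (δ + 2 * (k : ℝ) * Real.pi)]
  linarith [le_of_mul_le_mul_left hk (by positivity)]

/-- The summability assertion at the heart of Theorem 4.9: with `λ(n,m) ≥ 1`,
`0 < d(n) ≤ h`, `0 ≤ δ(n,m) < 2π`, and `(n,m) ↦ λ(n,m)^{-p/2}` summable (`p > 2`), the
family `(λ(n,m)² + (δ(n,m) + 2kπ)²/d(n)²)^{-p/2}` indexed over `(n,k,m) ∈ ℕ × ℤ × ℕ` is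
summable (so that `L_W⁻¹` belongs to the Schatten class `C_p`). -/
theorem characteristic_numbers_summable
    (p h : ℝ) (hp : 2 < p) (hh : 0 < h)
    (d : ℕ → ℝ) (hd : ∀ n, 0 < d n ∧ d n ≤ h)
    (lam : ℕ → ℕ → ℝ) (hlam : ∀ n m, 1 ≤ lam n m)
    (δ : ℕ → ℕ → ℝ) (hδ : ∀ n m, 0 ≤ δ n m ∧ δ n m < 2 * Real.pi)
    (hsum : Summable fun nm : ℕ × ℕ => lam nm.1 nm.2 ^ (-(p / 2))) :
    Summable fun x : ℕ × ℤ × ℕ =>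
      (lam x.1 x.2.2 ^ 2 + (δ x.1 x.2.2 + 2 * (x.2.1 : ℝ) * Real.pi) ^ 2 / d x.1 ^ 2)
        ^ (-(p / 2)) := by
  have hpos : ∀ n m, 0 < lam n m := fun n m => one_pos.trans_le (hlam n m)
  have hprod : Summable fun y : (ℕ × ℕ) × ℤ =>
      lam y.1.1 y.1.2 ^ (-(p / 2)) * (1 + |(y.2 : ℝ)|) ^ (-(p / 2)) :=
    hsum.mul_of_nonneg (summable_one_add_abs_int_rpow (by linarith))
      (fun y => Real.rpow_nonneg (hpos _ _).le _) (fun k => by positivity)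
  have hreindex : Function.Injective fun x : ℕ × ℤ × ℕ => ((x.1, x.2.2), x.2.1) := by
    rintro ⟨n, k, m⟩ ⟨n', k', m'⟩ hx
    simp_all
  refine Summable.of_nonneg_of_le (fun x => by positivity) ?_
    ((hprod.comp_injective hreindex).mul_left ((2 + h)⁻¹ ^ (-(p / 2))))
  rintro ⟨n, k, m⟩
  have hl := hpos n m
  have hl1 := hlam n m
  have hk := abs_int_le_one_add_mul_abs_div (hd n).1 (hd n).2 (hδ n m).1 (hδ n m).2 k
  simp only [Function.comp_apply]
  rw [← Real.mul_rpow hl.le (by positivity), ← Real.mul_rpow (by positivity) (by positivity),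
    ← div_pow]
  refine Real.rpow_le_rpow_of_nonpos (by positivity) ?_ (by linarith)
  rw [inv_mul_le_iff₀ (by positivity)]
  set t := (δ n m + 2 * (k : ℝ) * Real.pi) / d n
  have hmean : lam n m * |t| ≤ lam n m ^ 2 + t ^ 2 := by
    nlinarith [sq_nonneg (lam n m - |t|), sq_abs t, sq_nonneg (lam n m), sq_nonneg t]
  calc lam n m * (1 + |(k : ℝ)|) ≤ lam n m * (2 + h * |t|) :=
        mul_le_mul_of_nonneg_left (by linarith) hl.le
    _ = 2 * lam n m + h * (lam n m * |t|) := by ring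
    _ ≤ 2 * (lam n m ^ 2 + t ^ 2) + h * (lam n m ^ 2 + t ^ 2) :=
        add_le_add (by nlinarith [sq_nonneg t]) (mul_le_mul_of_nonneg_left hmean hh.le)
    _ = (2 + h) * (lam n m ^ 2 + t ^ 2) := by ring
end
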